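/- Let n ≥ 3 be an integer. Let r₀, r₁ : ℝ → ℝ be functions such that for every d < 0: r₀(d) > 0 and sinh(r₀(d))^(n-1) + (n-1)·I_{n-1}(r₀(d)) + d = 0, and r₁(d) > 0 and (n-1)·I_{n-1}(r₁(d)) + d = 0. Define h*(d) = −∫_{r₀(d)}^{r₁(d)} ((n-1)·I_{n-1}(t) + d)/sinh(t)^(n-1) dt. Then h*(d)/r₁(d)^(n/(n-1)) tends to (1/(n−2))·((n−1)/n)^(1/(n−1)) as d tends to 0 from the left. -/

import Mathlib

/-- `I_m(t) = ∫₀^t sinh(τ)^m dτ`. -/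
noncomputable def Ifun (m : ℕ) (t : ℝ) : ℝ := ∫ τ in (0:ℝ)..t, Real.sinh τ ^ m

open Filter Topology Set

lemma Real.sinh_le_mul_cosh {t : ℝ} (ht : 0 ≤ t) : Real.sinh t ≤ t * Real.cosh t := by
  have h : MonotoneOn (fun x : ℝ => x * Real.cosh x - Real.sinh x) (Ici 0) := by
    apply monotoneOn_of_deriv_nonneg (convex_Ici 0) (by fun_prop) (by fun_prop)
    intro x hx
    rw [interior_Ici] at hx
    have hd : HasDerivAt (fun x : ℝ => x * Real.cosh x - Real.sinh x)
        (1 * Real.cosh x + x * Real.sinh x - Real.cosh x) x :=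
      ((hasDerivAt_id' x).mul (Real.hasDerivAt_cosh x)).sub (Real.hasDerivAt_sinh x)
    rw [hd.deriv]
    have := mul_nonneg (le_of_lt hx) (Real.sinh_nonneg_iff.2 (le_of_lt hx))
    linarith
  have := h self_mem_Ici ht ht
  simp only [zero_mul, Real.sinh_zero, sub_zero] at this
  linarith

lemma intervalIntegrable_sinh_pow (m : ℕ) (a b : ℝ) :
    IntervalIntegrable (fun τ => Real.sinh τ ^ m) MeasureTheory.volume a b :=
  (by fun_prop : Continuous fun τ => Real.sinh τ ^ m).intervalIntegrable a b

lemma continuous_Ifun (m : ℕ) : Continuous (Ifun m) :=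
  intervalIntegral.continuous_primitive (intervalIntegrable_sinh_pow m) 0

lemma Ifun_nonneg (m : ℕ) {t : ℝ} (ht : 0 ≤ t) : 0 ≤ Ifun m t :=
  intervalIntegral.integral_nonneg ht fun _ hx => pow_nonneg (Real.sinh_nonneg_iff.2 hx.1) m

lemma Ifun_mono (m : ℕ) {s t : ℝ} (hs : 0 ≤ s) (hst : s ≤ t) : Ifun m s ≤ Ifun m t := by
  have h := intervalIntegral.integral_add_adjacent_intervals
    (intervalIntegrable_sinh_pow m 0 s) (intervalIntegrable_sinh_pow m s t)
  have : 0 ≤ ∫ τ in s..t, Real.sinh τ ^ m := intervalIntegral.integral_nonneg hst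
    fun _ hx => pow_nonneg (Real.sinh_nonneg_iff.2 (hs.trans hx.1)) m
  unfold Ifun
  linarith

lemma Ifun_le_mul_sinh_pow (m : ℕ) {t : ℝ} (ht : 0 ≤ t) : Ifun m t ≤ t * Real.sinh t ^ m := by
  have h := intervalIntegral.integral_mono_on ht (intervalIntegrable_sinh_pow m 0 t)
    (intervalIntegrable_const (c := Real.sinh t ^ m)) fun x hx =>
      pow_le_pow_left₀ (Real.sinh_nonneg_iff.2 hx.1) (Real.sinh_le_sinh.2 hx.2) m
  simpa [Ifun] using h

lemma pow_succ_div_le_Ifun (m : ℕ) {t : ℝ} (ht : 0 ≤ t) : t ^ (m + 1) / (m + 1) ≤ Ifun m t := by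
  have h := intervalIntegral.integral_mono_on ht
    (intervalIntegral.intervalIntegrable_pow (μ := MeasureTheory.volume) m)
    (intervalIntegrable_sinh_pow m 0 t) fun x hx =>
      pow_le_pow_left₀ hx.1 (Real.self_le_sinh_iff.2 hx.1) m
  simpa [Ifun] using h

lemma Real.sinh_pow_le_cosh_pow_mul {x t : ℝ} (m : ℕ) (hx : 0 ≤ x) (hxt : x ≤ t) :
    Real.sinh x ^ m ≤ Real.cosh t ^ m * x ^ m := by
  rw [← mul_pow]
  refine pow_le_pow_left₀ (Real.sinh_nonneg_iff.2 hx) ((Real.sinh_le_mul_cosh hx).trans ?_) m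
  rw [mul_comm]
  gcongr
  rw [Real.cosh_le_cosh, abs_of_nonneg hx, abs_of_nonneg (hx.trans hxt)]
  exact hxt

lemma Ifun_le_cosh_pow_mul (m : ℕ) {t : ℝ} (ht : 0 ≤ t) :
    Ifun m t ≤ Real.cosh t ^ m * (t ^ (m + 1) / (m + 1)) := by
  have h := intervalIntegral.integral_mono_on ht (intervalIntegrable_sinh_pow m 0 t)
    ((intervalIntegral.intervalIntegrable_pow (μ := MeasureTheory.volume) m).const_mul
      (Real.cosh t ^ m)) fun x hx => Real.sinh_pow_le_cosh_pow_mul m hx.1 hx.2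
  simpa [Ifun] using h

lemma integral_inv_pow {m : ℕ} (hm : 2 ≤ m) {a b : ℝ} (ha : 0 < a) (hab : a ≤ b) :
    ∫ t in a..b, (t ^ m)⁻¹ = (a / a ^ m - b / b ^ m) / ((m : ℝ) - 1) := by
  have hb := ha.trans_le hab
  have h0 : (0 : ℝ) ∉ uIcc a b := by
    rw [uIcc_of_le hab]; exact fun h => absurd h.1 (not_le.2 ha)
  have h := integral_zpow (a := a) (b := b) (n := -(m : ℤ)) (Or.inr ⟨by omega, h0⟩)
  simp only [zpow_neg, zpow_natCast, zpow_add₀ ha.ne', zpow_add₀ hb.ne', zpow_one] at h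
  rw [h]
  have : (m : ℝ) - 1 ≠ 0 := by
    have : (2 : ℝ) ≤ m := by exact_mod_cast hm
    linarith
  have h' : (-(m : ℝ) + 1) ≠ 0 := by contrapose! this; linarith
  push_cast
  field_simp
  ring

section Bounds

variable {m : ℕ} {D r s : ℝ}

lemma root_le (hr : 0 < r) (hs : 0 < s) (h₀ : Real.sinh r ^ m + m * Ifun m r = D)
    (h₁ : m * Ifun m s = D) : r ≤ s := by
  by_contra! h
  have := mul_le_mul_of_nonneg_left (Ifun_mono m hs.le h.le) (Nat.cast_nonneg (α := ℝ) m)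
  have := pow_pos (Real.sinh_pos_iff.2 hr) m
  linarith

lemma continuousOn_inv_pow {f : ℝ → ℝ} (hf : Continuous f) (hr : 0 < r) (hrs : r ≤ s)
    (hpos : ∀ x, 0 < x → 0 < f x) : ContinuousOn (fun t => (f t ^ m)⁻¹) (uIcc r s) := by
  rw [uIcc_of_le hrs]
  exact (hf.pow m).continuousOn.inv₀ fun x hx => (pow_pos (hpos x (hr.trans_le hx.1)) m).ne'

lemma intervalIntegrable_inv_pow (hr : 0 < r) (hrs : r ≤ s) :
    IntervalIntegrable (fun t : ℝ => (t ^ m)⁻¹) MeasureTheory.volume r s :=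
  (continuousOn_inv_pow continuous_id hr hrs fun _ hx => hx).intervalIntegrable

lemma intervalIntegrable_height (hr : 0 < r) (hrs : r ≤ s) :
    IntervalIntegrable (fun t => (D - m * Ifun m t) / Real.sinh t ^ m)
      MeasureTheory.volume r s := by
  have hc := continuous_Ifun m
  simp only [div_eq_mul_inv]
  exact ((by fun_prop : Continuous fun t => D - m * Ifun m t).continuousOn.mul
    (continuousOn_inv_pow Real.continuous_sinh hr hrs
      fun _ hx => Real.sinh_pos_iff.2 hx)).intervalIntegrable

lemma height_le (hm : 2 ≤ m) (hD : 0 < D) (hr : 0 < r) (hrs : r ≤ s) :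
    ∫ t in r..s, (D - m * Ifun m t) / Real.sinh t ^ m ≤ D / r ^ m * r / ((m : ℝ) - 1) := by
  have hm' : (2 : ℝ) ≤ m := by exact_mod_cast hm
  have h := intervalIntegral.integral_mono_on hrs (intervalIntegrable_height (D := D) hr hrs)
    ((intervalIntegrable_inv_pow (m := m) hr hrs).const_mul D) fun x hx => by
      have hx0 := hr.trans_le hx.1
      have := mul_nonneg (Nat.cast_nonneg (α := ℝ) m) (Ifun_nonneg m hx0.le)
      rw [← div_eq_mul_inv]
      have := Real.self_le_sinh_iff.2 hx0.le
      gcongr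
      linarith
  rw [intervalIntegral.integral_const_mul, integral_inv_pow hm hr hrs] at h
  refine h.trans ?_
  have hs := hr.trans_le hrs
  have : 0 ≤ s / s ^ m := by positivity
  rw [← mul_div_assoc, div_mul_eq_mul_div, mul_div_assoc D r]
  gcongr
  · linarith
  · linarith

lemma le_height (hm : 2 ≤ m) (hD : 0 < D) (hr : 0 < r) (hrs : r ≤ s) :
    (Real.cosh s ^ m)⁻¹ * ((D / r ^ m * r - D / s ^ (m + 1) * s ^ 2) / ((m : ℝ) - 1))
      - m * s ^ 2 ≤ ∫ t in r..s, (D - m * Ifun m t) / Real.sinh t ^ m := by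
  have hs := hr.trans_le hrs
  have h := intervalIntegral.integral_mono_on hrs
    (((intervalIntegrable_inv_pow (m := m) hr hrs).const_mul (D * (Real.cosh s ^ m)⁻¹)).sub
      (intervalIntegrable_const (c := m * s)))
    (intervalIntegrable_height (D := D) hr hrs) fun x hx => by
      have hx0 := hr.trans_le hx.1
      have hsh := pow_pos (Real.sinh_pos_iff.2 hx0) m
      rw [sub_div]
      apply sub_le_sub
      · rw [mul_assoc, ← mul_inv, ← div_eq_mul_inv]
        have := Real.sinh_pow_le_cosh_pow_mul m hx0.le hx.2
        gcongr
      · rw [div_le_iff₀ hsh, mul_assoc]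
        gcongr
        refine (Ifun_le_mul_sinh_pow m hx0.le).trans ?_
        gcongr
        exact hx.2
  rw [intervalIntegral.integral_sub ((intervalIntegrable_inv_pow hr hrs).const_mul _)
    intervalIntegrable_const, intervalIntegral.integral_const_mul, integral_inv_pow hm hr hrs,
    intervalIntegral.integral_const, smul_eq_mul] at h
  refine le_trans (sub_le_sub (le_of_eq ?_) ?_) h
  · field_simp
    ring
  · have : 0 ≤ r * (m * s) := by positivity
    linarith

end Bounds

lemma tendsto_zero_of_pow {α : Type*} {l : Filter α} {f : α → ℝ} {k : ℕ} (hk : k ≠ 0)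
    (hf : ∀ᶠ x in l, 0 ≤ f x) (h : Tendsto (fun x => f x ^ k) l (𝓝 0)) : Tendsto f l (𝓝 0) := by
  have hk' : (0 : ℝ) < (k : ℝ)⁻¹ := by positivity
  have := h.rpow_const (p := (k : ℝ)⁻¹) (Or.inr hk'.le)
  rw [Real.zero_rpow hk'.ne'] at this
  refine this.congr' ?_
  filter_upwards [hf] with x hx using Real.pow_rpow_inv_natCast hx hk

/-- The asymptotics of the height integral, with `D = -d` and `m = n - 1`. -/
theorem tendsto_height {α : Type*} {l : Filter α} {m : ℕ} (hm : 2 ≤ m) {D r s : α → ℝ}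
    (hD : Tendsto D l (𝓝 0)) (hpos : ∀ᶠ d in l, 0 < D d)
    (hr : ∀ᶠ d in l, 0 < r d) (hs : ∀ᶠ d in l, 0 < s d)
    (h₀ : ∀ᶠ d in l, Real.sinh (r d) ^ m + m * Ifun m (r d) = D d)
    (h₁ : ∀ᶠ d in l, m * Ifun m (s d) = D d) :
    Tendsto (fun d => (∫ t in r d..s d, (D d - m * Ifun m t) / Real.sinh t ^ m) /
        s d ^ (((m : ℝ) + 1) / m)) l
      (𝓝 (1 / ((m : ℝ) - 1) * ((m : ℝ) / (m + 1)) ^ (1 / (m : ℝ)))) := by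
  have hm' : (2 : ℝ) ≤ m := by exact_mod_cast hm
  have hm0 : m ≠ 0 := by omega
  have hs0 : Tendsto s l (𝓝 0) := by
    refine tendsto_zero_of_pow (Nat.succ_ne_zero m) (hs.mono fun _ h => h.le) ?_
    have hlim := hD.const_mul (((m : ℝ) + 1) / m)
    rw [mul_zero] at hlim
    refine squeeze_zero' (hs.mono fun _ h => by positivity) ?_ hlim
    filter_upwards [hs, h₁] with d hs h₁
    have := pow_succ_div_le_Ifun m hs.le
    rw [div_le_iff₀ (by positivity)] at this
    rw [← h₁]
    refine this.trans (le_of_eq ?_)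
    field_simp
  have hc : Tendsto (fun d => Real.cosh (s d) ^ m) l (𝓝 1) := by
    simpa using ((Real.continuous_cosh.tendsto 0).comp hs0).pow m
  have he : Tendsto (fun d => D d / s d ^ (m + 1)) l (𝓝 ((m : ℝ) / (m + 1))) := by
    have hlim := hc.mul_const ((m : ℝ) / (m + 1))
    rw [one_mul] at hlim
    refine tendsto_of_tendsto_of_tendsto_of_le_of_le' tendsto_const_nhds hlim ?_ ?_
    · filter_upwards [hs, h₁] with d hs h₁
      rw [le_div_iff₀ (by positivity), ← h₁, div_mul_eq_mul_div, mul_div_assoc]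
      gcongr
      exact pow_succ_div_le_Ifun m hs.le
    · filter_upwards [hs, h₁] with d hs h₁
      rw [div_le_iff₀ (by positivity), ← h₁]
      refine (mul_le_mul_of_nonneg_left (Ifun_le_cosh_pow_mul m hs.le)
        (Nat.cast_nonneg m)).trans (le_of_eq ?_)
      ring
  have hb : Tendsto (fun d => D d / r d ^ m) l (𝓝 1) := by
    have hlim := hc.mul ((hs0.const_mul (m : ℝ)).const_add 1)
    rw [mul_zero, add_zero, one_mul] at hlim
    refine tendsto_of_tendsto_of_tendsto_of_le_of_le' tendsto_const_nhds hlim ?_ ?_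
    · filter_upwards [hr, h₀] with d hr h₀
      rw [le_div_iff₀ (by positivity), ← h₀, one_mul]
      have := pow_le_pow_left₀ hr.le (Real.self_le_sinh_iff.2 hr.le) m
      have := mul_nonneg (Nat.cast_nonneg (α := ℝ) m) (Ifun_nonneg m hr.le)
      linarith
    · filter_upwards [hr, hs, h₀, h₁] with d hr hs h₀ h₁
      have hrs := root_le hr hs h₀ h₁
      rw [div_le_iff₀ (by positivity), ← h₀]
      have h1 := mul_le_mul_of_nonneg_left (Ifun_le_mul_sinh_pow m hr.le)
        (Nat.cast_nonneg (α := ℝ) m)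
      have hsh := Real.sinh_pos_iff.2 hr
      calc Real.sinh (r d) ^ m + m * Ifun m (r d)
          ≤ Real.sinh (r d) ^ m * (1 + m * r d) := by linarith
        _ ≤ (Real.cosh (s d) ^ m * r d ^ m) * (1 + m * s d) := by
            gcongr
            exact Real.sinh_pow_le_cosh_pow_mul m hr.le hrs
        _ = _ := by ring
  have ha : Tendsto (fun d => r d / s d ^ (((m : ℝ) + 1) / m)) l
      (𝓝 (((m : ℝ) / (m + 1)) ^ (1 / (m : ℝ)))) := by
    have hlim := (he.div hb one_ne_zero).rpow_const (p := 1 / (m : ℝ)) (Or.inr (by positivity))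
    rw [div_one] at hlim
    refine hlim.congr' ?_
    filter_upwards [hr, hs, hpos] with d hr hs hpos
    have : (D d / s d ^ (m + 1)) / (D d / r d ^ m) = r d ^ m / s d ^ (m + 1) := by
      field_simp
    simp only [Pi.div_apply]
    rw [this, Real.div_rpow (by positivity) (by positivity), one_div,
      Real.pow_rpow_inv_natCast hr.le hm0, ← Real.rpow_natCast (s d), ← Real.rpow_mul hs.le]
    push_cast
    rfl
  have hq : Tendsto (fun d => s d ^ 2 / s d ^ (((m : ℝ) + 1) / m)) l (𝓝 0) := by
    have hp : 0 < 2 - ((m : ℝ) + 1) / m := by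
      rw [sub_pos, div_lt_iff₀ (by positivity)]
      linarith
    have hlim := hs0.rpow_const (p := 2 - ((m : ℝ) + 1) / m) (Or.inr hp.le)
    rw [Real.zero_rpow hp.ne'] at hlim
    refine hlim.congr' ?_
    filter_upwards [hs] with d hs
    rw [Real.rpow_sub hs, Real.rpow_two]
  have hupper := (hb.mul ha).div_const ((m : ℝ) - 1)
  have hlower := ((hc.inv₀ one_ne_zero).mul
    (((hb.mul ha).sub (he.mul hq)).div_const ((m : ℝ) - 1))).sub (hq.const_mul (m : ℝ))
  have hL : (1 : ℝ) / ((m : ℝ) - 1) * ((m : ℝ) / (m + 1)) ^ (1 / (m : ℝ))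
      = ((m : ℝ) / (m + 1)) ^ (1 / (m : ℝ)) / ((m : ℝ) - 1) := by ring
  rw [hL]
  simp only [inv_one, one_mul, mul_zero, sub_zero] at hupper hlower
  refine tendsto_of_tendsto_of_tendsto_of_le_of_le' hlower hupper ?_ ?_
  · filter_upwards [hr, hs, h₀, h₁, hpos] with d hr hs h₀ h₁ hpos
    have hq0 : 0 < s d ^ (((m : ℝ) + 1) / m) := Real.rpow_pos_of_pos hs _
    refine le_trans (le_of_eq ?_) (div_le_div_of_nonneg_right
      (le_height hm hpos hr (root_le hr hs h₀ h₁)) hq0.le)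
    ring
  · filter_upwards [hr, hs, h₀, h₁, hpos] with d hr hs h₀ h₁ hpos
    have hq0 : 0 < s d ^ (((m : ℝ) + 1) / m) := Real.rpow_pos_of_pos hs _
    refine (div_le_div_of_nonneg_right
      (height_le hm hpos hr (root_le hr hs h₀ h₁)) hq0.le).trans (le_of_eq ?_)
    ring

/-- For `n ≥ 3`, with `r₀(d) = r_{0,d}`, `r₁(d) = r_{1,d}` and
`h*(d) = −∫_{r₀(d)}^{r₁(d)} ((n-1)I_{n-1}(t)+d)/sinh(t)^(n-1) dt`, one has
`h*(d)/r₁(d)^(n/(n-1)) → (1/(n−2))·((n−1)/n)^(1/(n−1))` as `d → 0⁻`. -/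
theorem statement16 (n : ℕ) (hn : 3 ≤ n) (r₀ r₁ : ℝ → ℝ)
    (h₀ : ∀ d : ℝ, d < 0 → 0 < r₀ d ∧
      Real.sinh (r₀ d) ^ (n - 1) + ((n : ℝ) - 1) * Ifun (n - 1) (r₀ d) + d = 0)
    (h₁ : ∀ d : ℝ, d < 0 →
      0 < r₁ d ∧ ((n : ℝ) - 1) * Ifun (n - 1) (r₁ d) + d = 0) :
    Filter.Tendsto
      (fun d : ℝ =>
        (-(∫ t in (r₀ d)..(r₁ d),
            (((n : ℝ) - 1) * Ifun (n - 1) t + d) / Real.sinh t ^ (n - 1))) /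
          (r₁ d) ^ ((n : ℝ) / ((n : ℝ) - 1)))
      (nhdsWithin 0 (Set.Iio 0))
      (nhds ((1 / ((n : ℝ) - 2)) * (((n : ℝ) - 1) / (n : ℝ)) ^ ((1 : ℝ) / ((n : ℝ) - 1)))) := by
  obtain ⟨m, rfl⟩ : ∃ m, n = m + 1 := ⟨n - 1, by omega⟩
  have hcast : ((m + 1 : ℕ) : ℝ) - 1 = m := by push_cast; ring
  simp only [hcast, Nat.add_sub_cancel] at h₀ h₁ ⊢
  have hneg : ∀ᶠ d : ℝ in 𝓝[<] 0, d < 0 := self_mem_nhdsWithin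
  have hD : Tendsto (fun d : ℝ => -d) (𝓝[<] 0) (𝓝 0) := by
    simpa using (continuous_neg.tendsto (0 : ℝ)).mono_left nhdsWithin_le_nhds
  have h := tendsto_height (m := m) (by omega) hD (hneg.mono fun _ hd => neg_pos.2 hd)
    (hneg.mono fun d hd => (h₀ d hd).1) (hneg.mono fun d hd => (h₁ d hd).1)
    (hneg.mono fun d hd => by linarith [(h₀ d hd).2])
    (hneg.mono fun d hd => by linarith [(h₁ d hd).2])
  convert h using 2 with d
  · rw [← intervalIntegral.integral_neg, Nat.cast_succ]
    congr 2
    ext t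
    ring
  · push_cast
    ring
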